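/- Let θ₀ > 4 be a real number, let K₀ := D̄(0,1) and K₁ := D̄(θ₀,1) be the closed discs of radius 1 centred at 0 and θ₀ respectively, and set L := K₀ ∪ K₁ (the discs are disjoint and are the connected components of L, and ℂ ∖ L is connected). Then ρ_L ≤ ((1 + θ₀) / ((θ₀/2)² − 1))^{1/2}. -/

import Mathlib

open Filter Topology Metric

/-- The `n`-th partial sum of the Taylor series of `f` at `z₀`:
`S_n(f,z₀)(z) = Σ_{k=0}^{n} (f^{(k)}(z₀)/k!)·(z−z₀)^k`. -/
noncomputable def taylorSum (f : ℂ → ℂ) (z₀ : ℂ) (n : ℕ) (z : ℂ) : ℂ :=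
  ∑ k ∈ Finset.range (n + 1), (iteratedDeriv k f z₀ / (Nat.factorial k)) * (z - z₀) ^ k

/-- Supremum norm of `g` on `X`. -/
noncomputable def supNorm (g : ℂ → ℂ) (X : Set ℂ) : ℝ :=
  sSup ((fun z => ‖g z‖) '' X)

/-- Membership in `A(X)`: continuous on `X` and holomorphic on the interior of `X`. -/
def memA (X : Set ℂ) (f : ℂ → ℂ) : Prop :=
  ContinuousOn f X ∧ DifferentiableOn ℂ f (interior X)

/-- Best sup-norm approximation error of `G` on `L` by polynomials of degree at most `n`. -/
noncomputable def dApprox (L : Set ℂ) (G : ℂ → ℂ) (n : ℕ) : ℝ :=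
  sInf {c : ℝ | ∃ p : Polynomial ℂ, p.degree ≤ (n : ℕ) ∧
    c = supNorm (fun z => G z - Polynomial.eval z p) L}

/-- The asymptotic quantity `limsup_n d_n(G)^{1/n}`; for a function `G` which is equal to a
different polynomial on each connected component of `L` this is the asymptotic convergence
factor `ρ_L` of `L`. -/
noncomputable def rho (L : Set ℂ) (G : ℂ → ℂ) : ℝ :=
  Filter.limsup (fun n : ℕ => dApprox L G n ^ (1 / (n : ℝ))) Filter.atTop

theorem exists_antideriv (p : Polynomial ℝ) (N : ℕ) (hp : p.natDegree ≤ N) :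
    ∃ R : Polynomial ℝ, R.natDegree ≤ N + 1 ∧ R.eval 0 = 0 ∧ R.derivative = p := by
  refine ⟨∑ i ∈ Finset.range (N + 1), Polynomial.monomial (i + 1) (p.coeff i / (i + 1)), ?_, ?_, ?_⟩
  · refine Polynomial.natDegree_sum_le_of_forall_le _ _ fun i hi => ?_
    refine (Polynomial.natDegree_monomial_le _).trans ?_
    have := Finset.mem_range.1 hi
    omega
  · simp [Polynomial.eval_finsetSum]
  · rw [Polynomial.derivative_sum]
    conv_rhs => rw [p.as_sum_range' (N + 1) (by omega)]
    refine Finset.sum_congr rfl fun i _ => ?_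
    rw [Polynomial.derivative_monomial]
    have : ((i : ℝ) + 1) ≠ 0 := by positivity
    simp [this]

theorem real_lower (θ : ℝ) (hθ : 4 < θ) (k : ℕ) (R : Polynomial ℝ)
    (h0 : R.eval 0 = 0)
    (hR : R.derivative = (Polynomial.X * (Polynomial.C θ - Polynomial.X)) ^ k) :
    2 * ((θ / 2) ^ 2 - 1) ^ k ≤ R.eval θ := by
  have hd : ∀ x, deriv (fun y => R.eval y) x = (x * (θ - x)) ^ k := by
    intro x
    rw [Polynomial.deriv, hR]; simp
  have hmono : MonotoneOn (fun y => R.eval y) (Set.Icc 0 θ) := by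
    refine monotoneOn_of_deriv_nonneg (convex_Icc 0 θ) R.continuous.continuousOn
      R.differentiable.differentiableOn fun x hx => ?_
    rw [hd]
    rw [interior_Icc] at hx
    have := hx.1
    have := sub_pos.2 hx.2
    positivity
  have hmid := Convex.mul_sub_le_image_sub_of_le_deriv (convex_Icc (θ / 2 - 1) (θ / 2 + 1))
    (f := fun y => R.eval y) R.continuous.continuousOn R.differentiable.differentiableOn
    (C := ((θ / 2) ^ 2 - 1) ^ k) (by
      intro x hx
      rw [interior_Icc] at hx
      rw [hd]
      refine pow_le_pow_left₀ (by nlinarith) ?_ k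
      nlinarith [mul_pos (sub_pos.2 hx.1) (sub_pos.2 hx.2)])
    (θ / 2 - 1) (by constructor <;> linarith) (θ / 2 + 1) (by constructor <;> linarith) (by linarith)
  have h1 := hmono (a := 0) (b := θ / 2 - 1) (by constructor <;> linarith)
    (by constructor <;> linarith) (by linarith)
  have h2 := hmono (a := θ / 2 + 1) (b := θ) (by constructor <;> linarith)
    (by constructor <;> linarith) (by linarith)
  simp only [h0] at h1 h2 hmid
  linarith

theorem disc_bound (θ : ℝ) (k : ℕ) (P : Polynomial ℂ) (M : ℝ) (hM : 0 ≤ M)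
    (hP : P.derivative = (Polynomial.X * (Polynomial.C (θ : ℂ) - Polynomial.X)) ^ k)
    (a : ℂ) (hb : ∀ z ∈ closedBall a 1, ‖z‖ * ‖(θ : ℂ) - z‖ ≤ M) (z : ℂ)
    (hz : z ∈ closedBall a 1) : ‖P.eval z - P.eval a‖ ≤ M ^ k := by
  have := (convex_closedBall a 1).norm_image_sub_le_of_norm_deriv_le (𝕜 := ℂ)
    (f := fun y => P.eval y) (C := M ^ k) (fun x _ => P.differentiableAt) (by
      intro x hx
      rw [Polynomial.deriv, hP]
      simp only [Polynomial.eval_pow, Polynomial.eval_mul, Polynomial.eval_X,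
        Polynomial.eval_sub, Polynomial.eval_C, norm_pow, norm_mul]
      exact pow_le_pow_left₀ (by positivity) (hb x hx) k)
    (mem_closedBall_self zero_le_one) hz
  refine this.trans ?_
  rw [mem_closedBall, dist_eq_norm] at hz
  have h : 0 ≤ M ^ k := by positivity
  nlinarith

theorem dApprox_nonneg (L : Set ℂ) (G : ℂ → ℂ) (n : ℕ) : 0 ≤ dApprox L G n := by
  refine Real.sInf_nonneg ?_
  rintro c ⟨p, _, rfl⟩
  refine Real.sSup_nonneg ?_
  rintro _ ⟨z, _, rfl⟩
  exact norm_nonneg _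

theorem dApprox_le (θ₀ : ℝ) (hθ : 4 < θ₀) (F : ℂ → ℂ)
    (hF0 : ∀ z ∈ Metric.closedBall (0:ℂ) 1, F z = 0)
    (hF1 : ∀ z ∈ Metric.closedBall ((θ₀ : ℂ)) 1, F z = 1) (k n : ℕ) (hk : 2 * k + 1 ≤ n) :
    dApprox (Metric.closedBall (0:ℂ) 1 ∪ Metric.closedBall ((θ₀ : ℂ)) 1) F n
      ≤ ((1 + θ₀) / ((θ₀ / 2) ^ 2 - 1)) ^ k := by
  obtain ⟨R, hdeg, h0, hR⟩ := exists_antideriv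
    ((Polynomial.X * (Polynomial.C θ₀ - Polynomial.X)) ^ k) (2 * k) (by
      refine Polynomial.natDegree_pow_le.trans ?_
      rw [mul_comm 2 k]
      refine Nat.mul_le_mul_left k ?_
      compute_degree)
  have hB := real_lower θ₀ hθ k R h0 hR
  have hq : 0 < (θ₀ / 2) ^ 2 - 1 := by nlinarith
  have hqk : 0 < ((θ₀ / 2) ^ 2 - 1) ^ k := pow_pos hq k
  set B := R.eval θ₀ with hBdef
  have hBpos : 0 < B := by linarith
  set P : Polynomial ℂ := R.map Complex.ofRealHom with hPdef
  have hP : P.derivative = (Polynomial.X * (Polynomial.C (θ₀ : ℂ) - Polynomial.X)) ^ k := by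
    rw [hPdef, Polynomial.derivative_map, hR]
    simp
  have hP0 : P.eval 0 = 0 := by
    have := Polynomial.eval_map_apply (p := R) Complex.ofRealHom 0
    rw [h0, map_zero] at this
    exact this
  have hP1 : P.eval (θ₀ : ℂ) = B := by
    have := Polynomial.eval_map_apply (p := R) Complex.ofRealHom θ₀
    simpa using this
  have hM : 0 ≤ 1 + θ₀ := by linarith
  have hn : ‖(θ₀ : ℂ)‖ = θ₀ := by
    rw [Complex.norm_real, Real.norm_eq_abs, abs_of_pos (by linarith)]
  have key : ∀ x : ℂ, ‖x‖ ≤ (1 + θ₀) ^ k →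
      ‖x / (B : ℂ)‖ ≤ ((1 + θ₀) / ((θ₀ / 2) ^ 2 - 1)) ^ k := by
    intro x hx
    rw [norm_div, Complex.norm_real, Real.norm_eq_abs, abs_of_pos hBpos, div_pow]
    refine div_le_div₀ (by positivity) hx hqk (by linarith)
  have hBc : (B : ℂ) ≠ 0 := by exact_mod_cast hBpos.ne'
  have hle : supNorm (fun z => F z - Polynomial.eval z (Polynomial.C (1 / (B : ℂ)) * P))
      (Metric.closedBall (0:ℂ) 1 ∪ Metric.closedBall ((θ₀ : ℂ)) 1)
      ≤ ((1 + θ₀) / ((θ₀ / 2) ^ 2 - 1)) ^ k := by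
    refine Real.sSup_le ?_ (by positivity)
    rintro _ ⟨z, hz | hz, rfl⟩
    · have hb := disc_bound θ₀ k P (1 + θ₀) hM hP 0 (by
        intro w hw
        rw [mem_closedBall_zero_iff] at hw
        have h1 := norm_sub_le (θ₀ : ℂ) w
        rw [hn] at h1
        nlinarith [norm_nonneg w, norm_nonneg ((θ₀ : ℂ) - w)]) z hz
      rw [hP0, sub_zero] at hb
      have := key _ hb
      simp only [hF0 z hz, Polynomial.eval_mul, Polynomial.eval_C, zero_sub, norm_neg]
      rwa [one_div, inv_mul_eq_div]
    · have hb := disc_bound θ₀ k P (1 + θ₀) hM hP θ₀ (by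
        intro w hw
        rw [mem_closedBall, dist_eq_norm] at hw
        have h1 := norm_add_le (θ₀ : ℂ) (w - θ₀)
        rw [hn, add_sub_cancel] at h1
        rw [norm_sub_rev]
        nlinarith [norm_nonneg w, norm_nonneg (w - (θ₀ : ℂ))]) z hz
      rw [hP1] at hb
      have := key _ hb
      simp only [hF1 z hz, Polynomial.eval_mul, Polynomial.eval_C]
      rw [norm_sub_rev]
      rwa [sub_div, div_self hBc, ← inv_mul_eq_div, ← one_div] at this
  refine le_trans (csInf_le ?_ ⟨Polynomial.C (1 / (B : ℂ)) * P, ?_, rfl⟩) hle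
  · refine ⟨0, ?_⟩
    rintro c ⟨p, _, rfl⟩
    refine Real.sSup_nonneg ?_
    rintro _ ⟨z, _, rfl⟩
    exact norm_nonneg _
  · refine Polynomial.degree_le_of_natDegree_le ?_
    refine (Polynomial.natDegree_C_mul_le _ _).trans ?_
    refine Polynomial.natDegree_map_le.trans ?_
    omega

/-- Example 3.1: for `θ₀ > 4` and `L = D̄(0,1) ∪ D̄(θ₀,1)`,
`ρ_L ≤ ((1 + θ₀)/((θ₀/2)² − 1))^{1/2}`. -/
theorem stmt9 (θ₀ : ℝ) (hθ : 4 < θ₀) (F : ℂ → ℂ)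
    (hF0 : ∀ z ∈ Metric.closedBall (0:ℂ) 1, F z = 0)
    (hF1 : ∀ z ∈ Metric.closedBall ((θ₀ : ℂ)) 1, F z = 1) :
    rho (Metric.closedBall (0:ℂ) 1 ∪ Metric.closedBall ((θ₀ : ℂ)) 1) F
      ≤ Real.sqrt ((1 + θ₀) / ((θ₀ / 2) ^ 2 - 1)) := by
  set q := (1 + θ₀) / ((θ₀ / 2) ^ 2 - 1) with hqdef
  have hq : 0 < q := div_pos (by linarith) (by nlinarith)
  set C : ℝ := max 1 (1 / q) with hC
  have hC1 : 1 ≤ C := le_max_left _ _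
  have hC2 : 1 / q ≤ C := le_max_right _ _
  have hs : 0 < Real.sqrt q := Real.sqrt_pos.2 hq
  -- square-root form of the bound
  have hbound : ∀ n : ℕ, 1 ≤ n →
      dApprox (Metric.closedBall (0:ℂ) 1 ∪ Metric.closedBall ((θ₀ : ℂ)) 1) F n
        ≤ (C * max 1 (1 / Real.sqrt q)) * Real.sqrt q ^ n := by
    intro n hn
    have h := dApprox_le θ₀ hθ F hF0 hF1 ((n - 1) / 2) n (by omega)
    refine h.trans ?_
    rw [← hqdef]
    have hsq : q = Real.sqrt q ^ 2 := (Real.sq_sqrt hq.le).symm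
    have e1 : 1 ≤ max 1 (1 / Real.sqrt q) := le_max_left _ _
    have e2 : 1 / Real.sqrt q ≤ max 1 (1 / Real.sqrt q) := le_max_right _ _
    rcases Nat.even_or_odd' n with ⟨j, rfl | rfl⟩
    · obtain ⟨i, rfl⟩ : ∃ i, j = i + 1 := ⟨j - 1, by omega⟩
      have : (2 * (i + 1) - 1) / 2 = i := by omega
      rw [this, pow_mul, ← hsq, pow_succ]
      have h3 : 1 / q * 1 ≤ C * max 1 (1 / Real.sqrt q) := by gcongr
      calc q ^ i = (1 / q * 1) * (q ^ i * q) := by field_simp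
        _ ≤ _ := by gcongr
    · have : (2 * j + 1 - 1) / 2 = j := by omega
      rw [this, pow_succ, pow_mul, ← hsq]
      have h3 : 1 * (1 / Real.sqrt q) ≤ C * max 1 (1 / Real.sqrt q) := by gcongr
      calc q ^ j = (1 * (1 / Real.sqrt q)) * (q ^ j * Real.sqrt q) := by field_simp
        _ ≤ _ := by gcongr
  set A := C * max 1 (1 / Real.sqrt q) with hA
  have hApos : 0 < A := by positivity
  have hlim : Tendsto (fun n : ℕ => A ^ (1 / (n : ℝ)) * Real.sqrt q) atTop
      (𝓝 (Real.sqrt q)) := by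
    have h1 : Tendsto (fun n : ℕ => A ^ (1 / (n : ℝ))) atTop (𝓝 (A ^ (0 : ℝ))) :=
      (Real.continuousAt_const_rpow hApos.ne').tendsto.comp tendsto_one_div_atTop_nhds_zero_nat
    simpa using h1.mul_const (Real.sqrt q)
  unfold rho
  rw [← hlim.limsup_eq]
  refine limsup_le_limsup ?_ ?_ hlim.isBoundedUnder_le
  · filter_upwards [eventually_ge_atTop 1] with n hn
    have hn' : (n : ℝ) ≠ 0 := by positivity
    refine (Real.rpow_le_rpow (dApprox_nonneg _ _ _) (hbound n hn) (by positivity)).trans ?_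
    rw [Real.mul_rpow hApos.le (by positivity), one_div, Real.pow_rpow_inv_natCast hs.le (by omega)]
  · refine IsBoundedUnder.isCoboundedUnder_le (isBoundedUnder_of ⟨0, fun n => ?_⟩)
    exact (Real.rpow_nonneg (dApprox_nonneg _ _ _) _)
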